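/- For every natural number t and every real c with −1/2 < c < 0, the function y ↦ h(c+iy) is integrable over ℝ and (1/(2π)) ∫_{−∞}^{∞} h(c+iy) dy = (4/π²) · (1)_t^4 / ((1/2)_t)^4, where h(s) = [(1/2+t)_s^3 (1/2)_s^2 / ((1+t)_s^3 (1+2t)_s)] · (10s²+6s+1+14st+4t²+4t) · Γ(−s) · 2^{2s}. -/

import Mathlib

open Complex MeasureTheory Real

/-- Rising factorial `(a)ₙ` for real `a` and natural `n`. -/
noncomputable def pochR (a : ℝ) (n : ℕ) : ℝ := ∏ i ∈ Finset.range n, (a + i)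

/-- Complex rising factorial `(a)ₛ = Γ(a+s)/Γ(a)`. -/
noncomputable def cpoch (a s : ℂ) : ℂ := Complex.Gamma (a + s) / Complex.Gamma a

/-- Complex power of a positive real base: `b^s = exp(s · log b)` with the real logarithm. -/
noncomputable def cpowR (b : ℝ) (s : ℂ) : ℂ := Complex.exp (s * (Real.log b : ℂ))

/-- The integrand `h` (depending on the natural parameter `t`). -/
noncomputable def h4 (t : ℕ) (s : ℂ) : ℂ :=
  (cpoch (1/2 + (t : ℂ)) s ^ 3 * cpoch (1/2) s ^ 2 /
      (cpoch (1 + (t : ℂ)) s ^ 3 * cpoch (1 + 2*(t : ℂ)) s)) *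
    (10*s^2 + 6*s + 1 + 14*s*(t : ℂ) + 4*(t : ℂ)^2 + 4*(t : ℂ)) *
    Complex.Gamma (-s) * cpowR 2 (2*s)


lemma aux_integrable {E : Type*} [NormedAddCommGroup E] (f : ℝ → E) (hf : Continuous f) (C : ℝ)
    (hC : ∀ y : ℝ, 1 ≤ |y| → ‖f y‖ ≤ C / y ^ 2) : Integrable f := by
  obtain ⟨M, hM⟩ := (isCompact_Icc (a := (-1 : ℝ)) (b := 1)).exists_bound_of_continuousOn
    hf.continuousOn
  have hM0 : 0 ≤ M := (norm_nonneg _).trans (hM 0 (by norm_num))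
  have hC0 : 0 ≤ C := by
    have := (norm_nonneg _).trans (hC 1 (by simp))
    simpa using this
  refine Integrable.mono' ((integrable_inv_one_add_sq).const_mul (2 * (M + C)))
    hf.aestronglyMeasurable (Filter.Eventually.of_forall fun y => ?_)
  by_cases hy : 1 ≤ |y|
  · have hy2 : 1 ≤ y ^ 2 := by rw [← sq_abs]; nlinarith
    refine (hC y hy).trans ?_
    rw [← div_eq_mul_inv, div_le_div_iff₀ (by positivity) (by positivity)]
    nlinarith [mul_nonneg hM0 (sq_nonneg y), mul_nonneg hC0 (sub_nonneg.2 hy2)]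
  · have hy1 : |y| ≤ 1 := (not_le.1 hy).le
    have hy2 : y ^ 2 ≤ 1 := by rw [← sq_abs]; nlinarith [abs_nonneg y]
    refine (hM y (abs_le.1 hy1)).trans ?_
    rw [← div_eq_mul_inv, le_div_iff₀ (by positivity)]
    nlinarith

lemma aux_line_cont (f : ℂ → ℂ) (a b x : ℝ) (hax : a ≤ x) (hxb : x ≤ b)
    (hd : DifferentiableOn ℂ f {s | a ≤ s.re ∧ s.re ≤ b}) :
    Continuous (fun y : ℝ => f ((x : ℂ) + (y : ℂ) * Complex.I)) := by
  rw [← continuousOn_univ]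
  refine hd.continuousOn.comp (by fun_prop) ?_
  intro y _
  simp [hax, hxb]

lemma aux_line_int (f : ℂ → ℂ) (a b x C : ℝ) (hax : a ≤ x) (hxb : x ≤ b)
    (hd : DifferentiableOn ℂ f {s | a ≤ s.re ∧ s.re ≤ b})
    (hC : ∀ s : ℂ, a ≤ s.re → s.re ≤ b → 1 ≤ |s.im| → ‖f s‖ ≤ C / s.im ^ 2) :
    Integrable (fun y : ℝ => f ((x : ℂ) + (y : ℂ) * Complex.I)) := by
  refine aux_integrable _ (aux_line_cont f a b x hax hxb hd) C ?_
  intro y hy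
  have := hC ((x : ℂ) + (y : ℂ) * Complex.I) (by simpa) (by simpa) (by simpa)
  simpa using this

lemma aux_shift (f : ℂ → ℂ) (a b C : ℝ) (hab : a ≤ b)
    (hd : DifferentiableOn ℂ f {s | a ≤ s.re ∧ s.re ≤ b})
    (hC : ∀ s : ℂ, a ≤ s.re → s.re ≤ b → 1 ≤ |s.im| → ‖f s‖ ≤ C / s.im ^ 2) :
    ∫ y : ℝ, f ((a : ℂ) + (y : ℂ) * Complex.I) = ∫ y : ℝ, f ((b : ℂ) + (y : ℂ) * Complex.I) := by
  have ia := aux_line_int f a b a C le_rfl hab hd hC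
  have ib := aux_line_int f a b b C hab le_rfl hd hC
  have ta := intervalIntegral_tendsto_integral ia Filter.tendsto_neg_atTop_atBot Filter.tendsto_id
  have tb := intervalIntegral_tendsto_integral ib Filter.tendsto_neg_atTop_atBot Filter.tendsto_id
  have t0 : Filter.Tendsto (fun T : ℝ => (∫ y in (-T)..(id T), f ((b : ℂ) + (y : ℂ) * Complex.I)) -
      ∫ y in (-T)..(id T), f ((a : ℂ) + (y : ℂ) * Complex.I)) Filter.atTop (nhds 0) := by
    have hlim : Filter.Tendsto (fun T : ℝ => 2 * (C * (b - a)) / T ^ 2) Filter.atTop (nhds 0) :=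
      tendsto_const_nhds.div_atTop (Filter.tendsto_pow_atTop (by norm_num))
    refine squeeze_zero_norm' ?_ hlim
    filter_upwards [Filter.eventually_ge_atTop (1 : ℝ)] with T hT
    have hT0 : 0 < T := by linarith
    have key := Complex.integral_boundary_rect_eq_zero_of_differentiableOn f
      ⟨a, -T⟩ ⟨b, T⟩ (hd.mono (by
        intro s hs
        rw [Complex.mem_reProdIm] at hs
        have := hs.1
        simp only [Set.uIcc_of_le hab] at this
        exact this))
    simp only [smul_eq_mul] at key
    have b1 : ‖∫ x in a..b, f ((x : ℂ) + ((-T : ℝ) : ℂ) * Complex.I)‖ ≤ C / T ^ 2 * |b - a| := by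
      refine intervalIntegral.norm_integral_le_of_norm_le_const fun x hx => ?_
      rw [Set.uIoc_of_le hab] at hx
      have := hC ((x : ℂ) + ((-T : ℝ) : ℂ) * Complex.I) (by simpa using hx.1.le)
        (by simpa using hx.2) (by simpa [abs_of_pos hT0] using hT)
      simpa using this
    have b2 : ‖∫ x in a..b, f ((x : ℂ) + (T : ℂ) * Complex.I)‖ ≤ C / T ^ 2 * |b - a| := by
      refine intervalIntegral.norm_integral_le_of_norm_le_const fun x hx => ?_
      rw [Set.uIoc_of_le hab] at hx
      have := hC ((x : ℂ) + (T : ℂ) * Complex.I) (by simpa using hx.1.le)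
        (by simpa using hx.2) (by simpa [abs_of_pos hT0] using hT)
      simpa using this
    rw [abs_of_nonneg (sub_nonneg.2 hab)] at b1 b2
    set A := ∫ x in a..b, f ((x : ℂ) + ((-T : ℝ) : ℂ) * Complex.I)
    set B := ∫ x in a..b, f ((x : ℂ) + (T : ℂ) * Complex.I)
    simp only [id]
    set X := ∫ y in (-T)..T, f ((b : ℂ) + (y : ℂ) * Complex.I)
    set Y := ∫ y in (-T)..T, f ((a : ℂ) + (y : ℂ) * Complex.I)
    have e : X - Y = Complex.I * (A - B) := by
      linear_combination (-Complex.I) * key + (X - Y) * Complex.I_mul_I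
    rw [e, norm_mul, Complex.norm_I, one_mul]
    calc ‖A - B‖ ≤ ‖A‖ + ‖B‖ := norm_sub_le _ _
      _ ≤ C / T ^ 2 * (b - a) + C / T ^ 2 * (b - a) := add_le_add b1 b2
      _ = _ := by ring
  have := tendsto_nhds_unique t0 (tb.sub ta)
  exact (sub_eq_zero.1 this.symm).symm

lemma norm_Gamma_le (s : ℂ) (hs : 0 < s.re) : ‖Complex.Gamma s‖ ≤ Real.Gamma s.re := by
  rw [Complex.Gamma_eq_integral hs, Real.Gamma_eq_integral hs, Complex.GammaIntegral]
  refine (norm_integral_le_integral_norm _).trans (le_of_eq ?_)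
  refine setIntegral_congr_fun measurableSet_Ioi fun x hx => ?_
  have hx : (0 : ℝ) < x := hx
  simp only [norm_mul]
  rw [Complex.norm_cpow_eq_rpow_re_of_pos hx, Complex.norm_real, Real.norm_eq_abs, abs_of_pos (Real.exp_pos _)]
  simp

lemma norm_Gamma_decay (k : ℕ) : ∀ (s : ℂ), 0 < s.re →
    ‖Complex.Gamma s‖ * |s.im| ^ k ≤ Real.Gamma (s.re + k) := by
  induction k with
  | zero => intro s hs; simpa using norm_Gamma_le s hs
  | succ k ih =>
    intro s hs
    have h0 : s ≠ 0 := by rintro rfl; simp at hs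
    have := ih (s + 1) (by simp; linarith)
    rw [Complex.Gamma_add_one s h0, norm_mul] at this
    simp only [Complex.add_re, Complex.one_re, Complex.add_im, Complex.one_im, add_zero] at this
    have e : s.re + ((k + 1 : ℕ) : ℝ) = s.re + 1 + k := by push_cast; ring
    rw [e]
    refine le_trans ?_ this
    have h1 : |s.im| ≤ ‖s‖ := Complex.abs_im_le_norm s
    calc ‖Complex.Gamma s‖ * |s.im| ^ (k + 1) = |s.im| * (‖Complex.Gamma s‖ * |s.im| ^ k) := by ring
      _ ≤ ‖s‖ * (‖Complex.Gamma s‖ * |s.im| ^ k) := by gcongr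
      _ = _ := by ring

lemma norm_Gamma_ratio (u : ℂ) (d : ℝ) (hu : 0 < u.re) (hd : 0 < d) :
    ‖Complex.Gamma u / Complex.Gamma (u + d)‖ ≤ Real.Gamma u.re / Real.Gamma (u.re + d) := by
  have h1 := Complex.Gamma_mul_Gamma_eq_betaIntegral hu (t := (d : ℂ)) (by simpa)
  have h2 := Complex.Gamma_mul_Gamma_eq_betaIntegral (s := (u.re : ℂ)) (t := (d : ℂ)) (by simpa) (by simpa)
  have g1 : Complex.Gamma (u + d) ≠ 0 := Complex.Gamma_ne_zero_of_re_pos (by simp; linarith)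
  have g2 : Real.Gamma (u.re + d) ≠ 0 := (Real.Gamma_pos_of_pos (by linarith)).ne'
  have g3 : 0 < Real.Gamma d := Real.Gamma_pos_of_pos hd
  have g3' : Complex.Gamma d ≠ 0 := Complex.Gamma_ne_zero_of_re_pos (by simpa)
  have hb : ‖Complex.betaIntegral u d‖ ≤ ‖Complex.betaIntegral (u.re : ℂ) d‖ := by
    have hr : Complex.betaIntegral (u.re : ℂ) d =
        ((∫ x in (0:ℝ)..1, x ^ (u.re - 1) * (1 - x) ^ (d - 1) : ℝ) : ℂ) := by
      rw [Complex.betaIntegral, ← intervalIntegral.integral_ofReal]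
      refine intervalIntegral.integral_congr fun x hx => ?_
      rw [Set.uIcc_of_le zero_le_one] at hx
      push_cast [Complex.ofReal_cpow hx.1, Complex.ofReal_cpow (sub_nonneg.2 hx.2)]
      rfl
    rw [hr, Complex.norm_real, Real.norm_eq_abs]
    refine le_trans ?_ (le_abs_self _)
    rw [Complex.betaIntegral]
    refine (intervalIntegral.norm_integral_le_integral_norm zero_le_one).trans (le_of_eq ?_)
    rw [intervalIntegral.integral_of_le zero_le_one, intervalIntegral.integral_of_le zero_le_one,
      MeasureTheory.integral_Ioc_eq_integral_Ioo, MeasureTheory.integral_Ioc_eq_integral_Ioo]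
    refine setIntegral_congr_fun measurableSet_Ioo fun x hx => ?_
    have hx1 : 0 < 1 - x := sub_pos.2 hx.2
    simp only [norm_mul]
    rw [Complex.norm_cpow_eq_rpow_re_of_pos hx.1]
    have : (1 - (x : ℂ)) = ((1 - x : ℝ) : ℂ) := by push_cast; ring
    rw [this, Complex.norm_cpow_eq_rpow_re_of_pos hx1]
    simp
  have e1 : Complex.Gamma u / Complex.Gamma (u + d) = Complex.betaIntegral u d / Complex.Gamma d := by
    rw [div_eq_div_iff g1 g3', h1]; ring
  have e2 : ((Real.Gamma u.re / Real.Gamma (u.re + d) : ℝ) : ℂ) =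
      Complex.betaIntegral u.re d / Complex.Gamma d := by
    rw [← Complex.ofReal_add, Complex.Gamma_ofReal, Complex.Gamma_ofReal, Complex.Gamma_ofReal] at h2
    rw [Complex.Gamma_ofReal]
    push_cast
    rw [div_eq_div_iff (by exact_mod_cast g2) (by exact_mod_cast g3.ne'), h2]; ring
  have e3 : Real.Gamma u.re / Real.Gamma (u.re + d) =
      ‖((Real.Gamma u.re / Real.Gamma (u.re + d) : ℝ) : ℂ)‖ := by
    rw [Complex.norm_real, Real.norm_eq_abs, abs_of_nonneg]
    exact div_nonneg (Real.Gamma_pos_of_pos hu).le (Real.Gamma_pos_of_pos (by linarith)).le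
  rw [e3, e2, e1, norm_div, norm_div]
  gcongr

lemma Gamma_mid (x : ℝ) (hx : 0 < x) :
    Real.Gamma (x + 1 / 2) ^ 2 ≤ Real.Gamma x * Real.Gamma (x + 1) := by
  have h := Real.Gamma_mul_add_mul_le_rpow_Gamma_mul_rpow_Gamma hx (t := x + 1) (by linarith)
    (a := 1 / 2) (b := 1 / 2) (by norm_num) (by norm_num) (by norm_num)
  have e : 1 / 2 * x + 1 / 2 * (x + 1) = x + 1 / 2 := by ring
  rw [e, ← Real.sqrt_eq_rpow, ← Real.sqrt_eq_rpow] at h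
  have p1 := (Real.Gamma_pos_of_pos hx).le
  have p2 := (Real.Gamma_pos_of_pos (show 0 < x + 1 by linarith)).le
  have p3 := (Real.Gamma_pos_of_pos (show 0 < x + 1/2 by linarith)).le
  calc _ ≤ (√(Real.Gamma x) * √(Real.Gamma (x + 1))) ^ 2 := by gcongr
    _ = _ := by rw [mul_pow, Real.sq_sqrt p1, Real.sq_sqrt p2]

lemma mellin_exp (c x : ℝ) (hc : c < 0) (hx : 0 < x)
    (hi : Integrable (fun y : ℝ => Complex.Gamma (-((c : ℂ) + (y : ℂ) * Complex.I)))) :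
    (1 / (2 * (π : ℂ))) * ∫ y : ℝ, Complex.Gamma (-((c : ℂ) + (y : ℂ) * Complex.I)) *
      cpowR x ((c : ℂ) + (y : ℂ) * Complex.I) = (Real.exp (-x) : ℂ) := by
  have hm : ∀ s : ℂ, 0 < s.re → mellin (fun t : ℝ => ((Real.exp (-t) : ℝ) : ℂ)) s = Complex.Gamma s := by
    intro s hs
    rw [Complex.Gamma_eq_integral hs, Complex.GammaIntegral, mellin]
    simp only [smul_eq_mul, mul_comm]
  have hconv : MellinConvergent (fun t : ℝ => ((Real.exp (-t) : ℝ) : ℂ)) ((-c : ℝ) : ℂ) := by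
    have := Complex.GammaIntegral_convergent (s := ((-c : ℝ) : ℂ)) (by simpa)
    rw [MellinConvergent]
    simpa only [smul_eq_mul, mul_comm] using this
  have hv : Complex.VerticalIntegrable (mellin (fun t : ℝ => ((Real.exp (-t) : ℝ) : ℂ))) (-c) := by
    rw [Complex.VerticalIntegrable]
    have := hi.comp_neg
    refine this.congr (Filter.Eventually.of_forall fun y => ?_)
    simp only
    rw [hm _ (by simpa)]
    push_cast
    ring_nf
  have key := mellinInv_mellin_eq (-c) (fun t : ℝ => ((Real.exp (-t) : ℝ) : ℂ)) hx hconv hv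
    (by fun_prop)
  rw [← key, mellinInv, ← integral_neg_eq_self, Complex.real_smul]
  congr 1
  · push_cast; ring
  · refine integral_congr_ae (Filter.Eventually.of_forall fun y => ?_)
    simp only [smul_eq_mul]
    rw [hm _ (by simpa), mul_comm, cpowR, Complex.cpow_def_of_ne_zero (by exact_mod_cast hx.ne'),
      ← Complex.ofReal_log hx.le]
    push_cast
    congr 2 <;> ring

noncomputable def Aof (t : ℕ) (s : ℂ) : ℂ :=
  (Complex.Gamma (1/2 + (t:ℂ) + s) / Complex.Gamma (1 + (t:ℂ) + s)) ^ 3 *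
    (Complex.Gamma (1/2 + s) / Complex.Gamma (1 + 2 * (t:ℂ) + s)) * Complex.Gamma (1/2 + s) *
    cpowR 2 (2 * s)

noncomputable def Kof (t : ℕ) : ℂ :=
  Complex.Gamma (1 + (t:ℂ)) ^ 3 * Complex.Gamma (1 + 2 * (t:ℂ)) /
    (Complex.Gamma (1/2 + (t:ℂ)) ^ 3 * Complex.Gamma (1/2) ^ 2)

noncomputable def Pof (t : ℕ) (s : ℂ) : ℂ :=
  10*s^2 + 6*s + 1 + 14*s*(t : ℂ) + 4*(t : ℂ)^2 + 4*(t : ℂ)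

noncomputable def Dof (t : ℕ) (x : ℝ) : ℝ :=
  (Real.Gamma (1/2 + t + x) / Real.Gamma (1 + t + x)) ^ 3 *
    (Real.Gamma (1/2 + x) / Real.Gamma (1 + 2 * t + x)) * Real.exp (2 * x * Real.log 2)

lemma h4_eq (t : ℕ) (s : ℂ) : h4 t s = Kof t * Aof t s * Pof t s * Complex.Gamma (-s) := by
  simp only [h4, Kof, Aof, Pof, cpoch, div_eq_mul_inv, mul_inv, inv_inv, mul_pow, inv_pow]
  ring

lemma Gamma_one_sub (s : ℂ) (hs : s ≠ 0) : Complex.Gamma (1 - s) = -s * Complex.Gamma (-s) := by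
  rw [← Complex.Gamma_add_one (-s) (neg_ne_zero.2 hs)]
  congr 1; ring

lemma h4_eq' (t : ℕ) (s : ℂ) (hs : s ≠ 0) :
    h4 t s = (Kof t * Pof t s / (-s)) * (Aof t s * Complex.Gamma (1 - s)) := by
  rw [h4_eq, Gamma_one_sub s hs]
  field_simp

lemma norm_cpowR (b : ℝ) (s : ℂ) : ‖cpowR b s‖ = Real.exp (s.re * Real.log b) := by
  rw [cpowR, Complex.norm_exp, Complex.re_mul_ofReal]

lemma norm_Aof_le (t : ℕ) (s : ℂ) (hs : -1/2 < s.re) :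
    ‖Aof t s‖ ≤ Dof t s.re * ‖Complex.Gamma (1/2 + s)‖ := by
  have ht : (0:ℝ) ≤ t := Nat.cast_nonneg t
  have r1 := norm_Gamma_ratio (1/2 + (t:ℂ) + s) (1/2) (by simp; linarith) (by norm_num)
  have r2 := norm_Gamma_ratio (1/2 + s) (1/2 + 2 * t) (by simp; linarith) (by positivity)
  have e1 : 1/2 + (t:ℂ) + s + ((1/2 : ℝ) : ℂ) = 1 + (t:ℂ) + s := by push_cast; ring
  have e2 : 1/2 + s + ((1/2 + 2 * (t:ℝ) : ℝ) : ℂ) = 1 + 2 * (t:ℂ) + s := by push_cast; ring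
  have f1 : (1/2 + (t:ℂ) + s).re = 1/2 + t + s.re := by simp
  have f2 : (1/2 + s).re = 1/2 + s.re := by simp
  have f3 : 1/2 + (t:ℝ) + s.re + 1/2 = 1 + t + s.re := by ring
  have f4 : 1/2 + s.re + (1/2 + 2 * (t:ℝ)) = 1 + 2 * t + s.re := by ring
  rw [e1, f1, f3] at r1
  rw [e2, f2, f4] at r2
  have r3 : ‖cpowR 2 (2 * s)‖ = Real.exp (2 * s.re * Real.log 2) := by
    rw [norm_cpowR]; simp
  have q1 := (norm_nonneg _).trans r1
  rw [Aof, Dof, norm_mul, norm_mul, norm_mul, norm_pow, r3]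
  calc _ ≤ (Real.Gamma (1/2 + t + s.re) / Real.Gamma (1 + t + s.re)) ^ 3 *
    (Real.Gamma (1/2 + s.re) / Real.Gamma (1 + 2 * t + s.re)) * ‖Complex.Gamma (1/2 + s)‖ *
      Real.exp (2 * s.re * Real.log 2) := by gcongr
    _ = _ := by ring

lemma Dof_nonneg (t : ℕ) (x : ℝ) (hx : -1/2 < x) : 0 ≤ Dof t x := by
  have ht : (0:ℝ) ≤ t := Nat.cast_nonneg t
  have g1 := Real.Gamma_pos_of_pos (show 0 < 1/2 + (t:ℝ) + x by linarith)
  have g2 := Real.Gamma_pos_of_pos (show 0 < 1 + (t:ℝ) + x by linarith)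
  have g3 := Real.Gamma_pos_of_pos (show 0 < 1/2 + x by linarith)
  have g4 := Real.Gamma_pos_of_pos (show 0 < 1 + 2 * (t:ℝ) + x by linarith)
  rw [Dof]; positivity

lemma contAt_Gamma (f : ℝ → ℝ) (x : ℝ) (hf : ContinuousAt f x) (h : 0 < f x) :
    ContinuousAt (fun x => Real.Gamma (f x)) x := by
  refine ContinuousAt.comp (g := Real.Gamma) (Real.differentiableAt_Gamma fun m => ?_).continuousAt hf
  have : (0:ℝ) ≤ m := Nat.cast_nonneg m
  linarith [show f x ≠ -m from by linarith]

lemma strip_bound (t : ℕ) (a b : ℝ) (ha : -1/2 < a) (hb : b < 1) :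
    ∃ C : ℝ, ∀ s : ℂ, a ≤ s.re → s.re ≤ b →
      ‖Aof t s * Complex.Gamma (1 - s)‖ * |s.im| ^ 4 ≤ C := by
  have ht : (0:ℝ) ≤ t := Nat.cast_nonneg t
  have hc : ContinuousOn (fun x : ℝ => Dof t x * Real.Gamma (1/2 + x + 4) * Real.Gamma (1 - x))
      (Set.Icc a b) := by
    intro x hx
    have h1 : -1/2 < x := by linarith [hx.1]
    have h2 : x < 1 := by linarith [hx.2]
    refine ContinuousAt.continuousWithinAt ?_
    have g2 := (Real.Gamma_pos_of_pos (show 0 < 1 + (t:ℝ) + x by linarith)).ne'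
    have g4 := (Real.Gamma_pos_of_pos (show 0 < 1 + 2 * (t:ℝ) + x by linarith)).ne'
    have c1 := contAt_Gamma (fun x => 1/2 + (t:ℝ) + x) x (by fun_prop) (by linarith)
    have c2 := contAt_Gamma (fun x => 1 + (t:ℝ) + x) x (by fun_prop) (by linarith)
    have c3 := contAt_Gamma (fun x => 1/2 + x) x (by fun_prop) (by linarith)
    have c4 := contAt_Gamma (fun x => 1 + 2 * (t:ℝ) + x) x (by fun_prop) (by linarith)
    have c5 := contAt_Gamma (fun x => 1/2 + x + 4) x (by fun_prop) (by linarith)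
    have c6 := contAt_Gamma (fun x => 1 - x) x (by fun_prop) (by linarith)
    have c7 : ContinuousAt (fun x : ℝ => Real.exp (2 * x * Real.log 2)) x := by fun_prop
    exact ((((((c1.div c2 g2).pow 3).mul (c3.div c4 g4)).mul c7).mul c5).mul c6)
  obtain ⟨C, hC⟩ := isCompact_Icc.exists_bound_of_continuousOn hc
  refine ⟨C, fun s h1 h2 => ?_⟩
  have h1' : -1/2 < s.re := by linarith
  refine le_trans ?_ ((le_abs_self _).trans (hC s.re ⟨h1, h2⟩))
  have b1 := norm_Aof_le t s h1'
  have b2 := norm_Gamma_decay 4 (1/2 + s) (by simp; linarith)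
  have b3 := norm_Gamma_le (1 - s) (by simp; linarith)
  simp only [Complex.add_re, Complex.add_im, Complex.sub_re, Complex.one_re] at b2 b3
  norm_num at b2
  rw [norm_mul]
  have d0 := Dof_nonneg t s.re h1'
  have p2 := (Real.Gamma_pos_of_pos (show 0 < 1/2 + s.re + 4 by linarith)).le
  calc ‖Aof t s‖ * ‖Complex.Gamma (1 - s)‖ * |s.im| ^ 4
      ≤ (Dof t s.re * ‖Complex.Gamma (1/2 + s)‖) * ‖Complex.Gamma (1 - s)‖ * |s.im| ^ 4 := by gcongr
    _ = Dof t s.re * (‖Complex.Gamma (1/2 + s)‖ * |s.im| ^ 4) * ‖Complex.Gamma (1 - s)‖ := by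
        ring
    _ ≤ Dof t s.re * Real.Gamma (1/2 + s.re + 4) * Real.Gamma (1 - s.re) := by gcongr

lemma quad_bound (α β γ s : ℂ) (h1 : -1 ≤ s.re) (h2 : s.re ≤ 1) (h : 1 ≤ |s.im|) :
    ‖α * s ^ 2 + β * s + γ‖ ≤ (4 * ‖α‖ + 2 * ‖β‖ + ‖γ‖) * s.im ^ 2 := by
  have hs : ‖s‖ ≤ 2 * |s.im| := by
    have := Complex.norm_le_abs_re_add_abs_im s
    have := abs_le.2 ⟨h1, h2⟩
    linarith
  have hi : |s.im| ≤ |s.im| ^ 2 := by nlinarith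
  have hi' : 1 ≤ |s.im| ^ 2 := by nlinarith
  rw [← sq_abs s.im]
  calc _ ≤ ‖α * s ^ 2‖ + ‖β * s‖ + ‖γ‖ := (norm_add_le _ _).trans (by gcongr; exact norm_add_le _ _)
    _ = ‖α‖ * ‖s‖ ^ 2 + ‖β‖ * ‖s‖ + ‖γ‖ := by rw [norm_mul, norm_mul, norm_pow]
    _ ≤ ‖α‖ * (2 * |s.im|) ^ 2 + ‖β‖ * (2 * |s.im| ^ 2) + ‖γ‖ * |s.im| ^ 2 := by
        gcongr
        · linarith
        · exact le_mul_of_one_le_right (norm_nonneg _) hi'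
    _ = _ := by ring

lemma F_bound (t : ℕ) (a b : ℝ) (ha : -1/2 < a) (hb : b < 1) (q : ℂ → ℂ) (M : ℝ)
    (hq : ∀ s : ℂ, a ≤ s.re → s.re ≤ b → 1 ≤ |s.im| → ‖q s‖ ≤ M * s.im ^ 2) :
    ∃ C : ℝ, ∀ s : ℂ, a ≤ s.re → s.re ≤ b → 1 ≤ |s.im| →
      ‖q s * (Aof t s * Complex.Gamma (1 - s))‖ ≤ C / s.im ^ 2 := by
  obtain ⟨C, hC⟩ := strip_bound t a b ha hb
  refine ⟨M * C, fun s h1 h2 h3 => ?_⟩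
  have k1 := hC s h1 h2
  have k2 := hq s h1 h2 h3
  have hi : 0 < s.im ^ 2 := by rw [← sq_abs]; positivity
  have hM : 0 ≤ M := by
    by_contra hM
    have := (norm_nonneg _).trans k2
    nlinarith
  rw [norm_mul, le_div_iff₀ hi]
  have e4 : |s.im| ^ 4 = s.im ^ 2 * s.im ^ 2 := by rw [← sq_abs]; ring
  rw [e4] at k1
  calc _ ≤ (M * s.im ^ 2) * ‖Aof t s * Complex.Gamma (1 - s)‖ * s.im ^ 2 := by gcongr
    _ = M * (‖Aof t s * Complex.Gamma (1 - s)‖ * (s.im ^ 2 * s.im ^ 2)) := by ring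
    _ ≤ _ := by gcongr

lemma diff_Gamma (f : ℂ → ℂ) (s : ℂ) (hf : DifferentiableAt ℂ f s) (h : 0 < (f s).re) :
    DifferentiableAt ℂ (fun s => Complex.Gamma (f s)) s := by
  refine DifferentiableAt.comp (g := Complex.Gamma) s (Complex.differentiableAt_Gamma _ fun m hm => ?_) hf
  have : (0:ℝ) ≤ m := Nat.cast_nonneg m
  rw [hm] at h
  simp at h
  linarith

lemma diff_Aof (t : ℕ) (s : ℂ) (hs : -1/2 < s.re) : DifferentiableAt ℂ (Aof t) s := by
  have ht : (0:ℝ) ≤ t := Nat.cast_nonneg t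
  have g2 : Complex.Gamma (1 + (t:ℂ) + s) ≠ 0 :=
    Complex.Gamma_ne_zero_of_re_pos (by simp; linarith)
  have g4 : Complex.Gamma (1 + 2 * (t:ℂ) + s) ≠ 0 :=
    Complex.Gamma_ne_zero_of_re_pos (by simp; linarith)
  have c1 := diff_Gamma (fun s => 1/2 + (t:ℂ) + s) s (by fun_prop) (by simp; linarith)
  have c2 := diff_Gamma (fun s => 1 + (t:ℂ) + s) s (by fun_prop) (by simp; linarith)
  have c3 := diff_Gamma (fun s => 1/2 + s) s (by fun_prop) (by simp; linarith)
  have c4 := diff_Gamma (fun s => 1 + 2 * (t:ℂ) + s) s (by fun_prop) (by simp; linarith)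
  have c7 : DifferentiableAt ℂ (fun s : ℂ => cpowR 2 (2 * s)) s := by unfold cpowR; fun_prop
  exact ((((c1.div c2 g2).pow 3).mul (c3.div c4 g4)).mul c3).mul c7

lemma diff_Gamma_one_sub (s : ℂ) (hs : s.re < 1) :
    DifferentiableAt ℂ (fun s => Complex.Gamma (1 - s)) s :=
  diff_Gamma _ s (by fun_prop) (by simp; linarith)

lemma one_le_norm_of_im (s : ℂ) (h : 1 ≤ |s.im|) : 1 ≤ ‖s‖ := h.trans (Complex.abs_im_le_norm s)

lemma line_ne_zero (x y : ℝ) (hx : x ≠ 0) : (x : ℂ) + (y : ℂ) * Complex.I ≠ 0 := by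
  intro h
  have := congrArg Complex.re h
  simp at this
  exact hx this

lemma Pof_quad (t : ℕ) (s : ℂ) :
    Pof t s = 10 * s ^ 2 + (14 * (t:ℂ) + 6) * s + (2 * (t:ℂ) + 1) ^ 2 := by
  rw [Pof]; ring

lemma h4_integrable (t : ℕ) (x : ℝ) (h1 : -1/2 < x) (h2 : x < 1) (h0 : x ≠ 0) :
    Integrable (fun y : ℝ => h4 t ((x : ℂ) + (y : ℂ) * Complex.I)) := by
  obtain ⟨C, hC⟩ := F_bound t x x h1 h2 (fun s => Kof t * Pof t s / (-s))
    (‖Kof t‖ * (4 * ‖(10:ℂ)‖ + 2 * ‖14 * (t:ℂ) + 6‖ + ‖(2 * (t:ℂ) + 1) ^ 2‖)) (by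
      intro s k1 k2 k3
      have hs := one_le_norm_of_im s k3
      rw [norm_div, norm_mul, norm_neg, Pof_quad]
      refine (div_le_self (by positivity) hs).trans ?_
      rw [mul_assoc]
      gcongr
      exact quad_bound _ _ _ s (by linarith) (by linarith) k3)
  have key := aux_line_int (fun s => (Kof t * Pof t s / (-s)) * (Aof t s * Complex.Gamma (1 - s)))
    x x x C le_rfl le_rfl (by
      intro s hs
      have hs0 : s ≠ 0 := by
        rintro rfl
        have := hs.1; have := hs.2
        simp at *
        exact h0 (by linarith)
      have d1 := diff_Aof t s (by linarith [hs.1])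
      have d2 := diff_Gamma_one_sub s (by linarith [hs.2])
      have d3 : DifferentiableAt ℂ (fun s => Kof t * Pof t s / (-s)) s := by
        unfold Pof
        refine DifferentiableAt.div (by fun_prop) (by fun_prop) (neg_ne_zero.2 hs0)
      exact (d3.mul (d1.mul d2)).differentiableWithinAt) hC
  refine key.congr (Filter.Eventually.of_forall fun y => ?_)
  simp only
  rw [h4_eq' t _ (line_ne_zero x y h0)]

noncomputable def vof (t : ℕ) (s : ℂ) : ℂ :=
  2 * s ^ 2 + (10 * (t:ℂ) + 4) * s + (8 * (t:ℂ) ^ 2 + 6 * (t:ℂ) + 1)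

noncomputable def Gof (t : ℕ) (s : ℂ) : ℂ :=
  (-(Kof t * vof t s / (2 * (t:ℂ) + 1 + s))) * (Aof t s * Complex.Gamma (1 - s))

lemma Aof_succ_s (t : ℕ) (s : ℂ) (hs : -1/2 < s.re) :
    Aof t (s + 1) = Aof t s * (4 * ((1/2 + (t:ℂ) + s) / (1 + (t:ℂ) + s)) ^ 3 * (1/2 + s) ^ 2 /
      (1 + 2 * (t:ℂ) + s)) := by
  have ht : (0:ℝ) ≤ t := Nat.cast_nonneg t
  have n1 : 1/2 + (t:ℂ) + s ≠ 0 := fun h => by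
    have := congrArg Complex.re h; simp at this; linarith
  have n2 : 1 + (t:ℂ) + s ≠ 0 := fun h => by
    have := congrArg Complex.re h; simp at this; linarith
  have n3 : 1/2 + s ≠ 0 := fun h => by
    have := congrArg Complex.re h; simp at this; linarith
  have n4 : 1 + 2 * (t:ℂ) + s ≠ 0 := fun h => by
    have := congrArg Complex.re h; simp at this; linarith
  have g2 : Complex.Gamma (1 + (t:ℂ) + s) ≠ 0 :=
    Complex.Gamma_ne_zero_of_re_pos (by simp; linarith)
  have g4 : Complex.Gamma (1 + 2 * (t:ℂ) + s) ≠ 0 :=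
    Complex.Gamma_ne_zero_of_re_pos (by simp; linarith)
  have hp : cpowR 2 (2 * (s + 1)) = 4 * cpowR 2 (2 * s) := by
    have : Complex.exp (2 * (Real.log 2 : ℂ)) = 4 := by
      rw [show (2:ℂ) * (Real.log 2 : ℂ) = ((2 * Real.log 2 : ℝ) : ℂ) by push_cast; ring,
        ← Complex.ofReal_exp, two_mul, Real.exp_add, Real.exp_log (by norm_num)]
      norm_num
    rw [cpowR, cpowR, ← this, ← Complex.exp_add]
    congr 1; ring
  rw [Aof, Aof, hp, ← add_assoc, ← add_assoc, ← add_assoc, ← add_assoc,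
    Complex.Gamma_add_one _ n1, Complex.Gamma_add_one _ n2, Complex.Gamma_add_one _ n3,
    Complex.Gamma_add_one _ n4]
  generalize Complex.Gamma (1/2 + (t:ℂ) + s) = X1
  generalize Complex.Gamma (1/2 + s) = X2
  generalize cpowR 2 (2 * s) = X3
  field_simp

lemma Aof_succ_t (t : ℕ) (s : ℂ) (hs : -1/2 < s.re) :
    Aof (t + 1) s = Aof t s * (((1/2 + (t:ℂ) + s) / (1 + (t:ℂ) + s)) ^ 3 /
      ((1 + 2 * (t:ℂ) + s) * (2 + 2 * (t:ℂ) + s))) := by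
  have ht : (0:ℝ) ≤ t := Nat.cast_nonneg t
  have n1 : 1/2 + (t:ℂ) + s ≠ 0 := fun h => by
    have := congrArg Complex.re h; simp at this; linarith
  have n2 : 1 + (t:ℂ) + s ≠ 0 := fun h => by
    have := congrArg Complex.re h; simp at this; linarith
  have n4 : 1 + 2 * (t:ℂ) + s ≠ 0 := fun h => by
    have := congrArg Complex.re h; simp at this; linarith
  have n5 : 1 + 2 * (t:ℂ) + s + 1 ≠ 0 := fun h => by
    have := congrArg Complex.re h; simp at this; linarith
  have g2 : Complex.Gamma (1 + (t:ℂ) + s) ≠ 0 :=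
    Complex.Gamma_ne_zero_of_re_pos (by simp; linarith)
  have g4 : Complex.Gamma (1 + 2 * (t:ℂ) + s) ≠ 0 :=
    Complex.Gamma_ne_zero_of_re_pos (by simp; linarith)
  rw [Aof, Aof]
  push_cast
  rw [show 1/2 + ((t:ℂ) + 1) + s = 1/2 + (t:ℂ) + s + 1 by ring,
    show 1 + ((t:ℂ) + 1) + s = 1 + (t:ℂ) + s + 1 by ring,
    show 1 + 2 * ((t:ℂ) + 1) + s = 1 + 2 * (t:ℂ) + s + 1 + 1 by ring,
    show 2 + 2 * (t:ℂ) + s = 1 + 2 * (t:ℂ) + s + 1 by ring,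
    Complex.Gamma_add_one _ n1, Complex.Gamma_add_one _ n2, Complex.Gamma_add_one _ n5,
    Complex.Gamma_add_one _ n4]
  generalize Complex.Gamma (1/2 + (t:ℂ) + s) = X1
  generalize Complex.Gamma (1/2 + s) = X2
  generalize cpowR 2 (2 * s) = X3
  field_simp

lemma Kof_succ (t : ℕ) :
    Kof (t + 1) = Kof t * (((1 + (t:ℂ)) / (1/2 + (t:ℂ))) ^ 3 *
      ((1 + 2 * (t:ℂ)) * (2 + 2 * (t:ℂ)))) := by
  have ht : (0:ℝ) ≤ t := Nat.cast_nonneg t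
  have n1 : 1/2 + (t:ℂ) ≠ 0 := fun h => by
    have := congrArg Complex.re h; simp at this; linarith
  have n2 : 1 + (t:ℂ) ≠ 0 := fun h => by
    have := congrArg Complex.re h; simp at this; linarith
  have n4 : 1 + 2 * (t:ℂ) ≠ 0 := fun h => by
    have := congrArg Complex.re h; simp at this; linarith
  have n5 : 1 + 2 * (t:ℂ) + 1 ≠ 0 := fun h => by
    have := congrArg Complex.re h; simp at this; linarith
  have g1 : Complex.Gamma (1/2 + (t:ℂ)) ≠ 0 :=
    Complex.Gamma_ne_zero_of_re_pos (by simp; linarith)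
  have g2 : Complex.Gamma (1/2) ≠ 0 :=
    Complex.Gamma_ne_zero_of_re_pos (by simp)
  rw [Kof, Kof]
  push_cast
  rw [show 1/2 + ((t:ℂ) + 1) = 1/2 + (t:ℂ) + 1 by ring,
    show 1 + ((t:ℂ) + 1) = 1 + (t:ℂ) + 1 by ring,
    show 1 + 2 * ((t:ℂ) + 1) = 1 + 2 * (t:ℂ) + 1 + 1 by ring,
    show 2 + 2 * (t:ℂ) = 1 + 2 * (t:ℂ) + 1 by ring,
    Complex.Gamma_add_one _ n1, Complex.Gamma_add_one _ n2, Complex.Gamma_add_one _ n5,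
    Complex.Gamma_add_one _ n4]
  generalize Complex.Gamma (1/2 + (t:ℂ)) = X1 at *
  generalize Complex.Gamma (1/2) = X2 at *
  generalize Complex.Gamma (1 + (t:ℂ)) = X3 at *
  generalize Complex.Gamma (1 + 2 * (t:ℂ)) = X4 at *
  field_simp

lemma wz_rat (t s : ℂ) (n1 : 1/2 + t ≠ 0) (n2 : 1 + t ≠ 0) (n3 : 1 + t + s ≠ 0)
    (n4 : 1 + 2 * t + s ≠ 0) (n5 : 2 + 2 * t + s ≠ 0) :
    (1/2 + t) ^ 4 / (1 + t) ^ 4 * ((((1 + t) / (1/2 + t)) ^ 3 *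
      ((1 + 2 * t) * (2 + 2 * t))) * (((1/2 + t + s) / (1 + t + s)) ^ 3 /
      ((1 + 2 * t + s) * (2 + 2 * t + s)))) *
      (10 * s ^ 2 + (14 * (t + 1) + 6) * s + (2 * (t + 1) + 1) ^ 2) -
      (10 * s ^ 2 + (14 * t + 6) * s + (2 * t + 1) ^ 2) =
    -((4 * ((1/2 + t + s) / (1 + t + s)) ^ 3 * (1/2 + s) ^ 2 / (1 + 2 * t + s)) *
      ((2 * (s + 1) ^ 2 + (10 * t + 4) * (s + 1) + (8 * t ^ 2 + 6 * t + 1)) / (2 * t + 1 + (s + 1)))) -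
      s * ((2 * s ^ 2 + (10 * t + 4) * s + (8 * t ^ 2 + 6 * t + 1)) / (2 * t + 1 + s)) := by
  have n4' : 2 * t + 1 + s ≠ 0 := by convert n4 using 1; ring
  have n5' : 2 * t + 1 + (s + 1) ≠ 0 := by convert n5 using 1; ring
  have e1 : (1/2 + t) ^ 4 / (1 + t) ^ 4 * ((((1 + t) / (1/2 + t)) ^ 3 *
      ((1 + 2 * t) * (2 + 2 * t))) * (((1/2 + t + s) / (1 + t + s)) ^ 3 /
      ((1 + 2 * t + s) * (2 + 2 * t + s)))) = (1 + 2 * t) ^ 2 * ((1/2 + t + s) / (1 + t + s)) ^ 3 /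
      ((1 + 2 * t + s) * (2 + 2 * t + s)) := by
    generalize (1/2 + t + s) / (1 + t + s) = Z
    generalize hb : (1/2 + t) = b at *
    have hb' : 1 + 2 * t = 2 * b := by rw [← hb]; ring
    generalize 1 + 2 * t + s = Y at *
    rw [hb', show 2 + 2 * t = 2 * (1 + t) by ring]
    rw [show 2 + 2 * t + s = 2 * (1 + t) + s by ring] at n5
    field_simp
  rw [e1, show 2 * t + 1 + (s + 1) = 2 + 2 * t + s by ring, show 2 * t + 1 + s = 1 + 2 * t + s by ring,
    div_pow]
  have n6 : 2 * (1 + t) + s ≠ 0 := by convert n5 using 1; ring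
  field_simp
  ring

lemma wz_point (t : ℕ) (s : ℂ) (hs : -1/2 < s.re) (h0 : s ≠ 0) :
    ((1/2 + (t:ℂ)) ^ 4 / (1 + (t:ℂ)) ^ 4) * h4 (t + 1) s - h4 t s = Gof t (s + 1) - Gof t s := by
  have ht : (0:ℝ) ≤ t := Nat.cast_nonneg t
  have n1 : 1/2 + (t:ℂ) ≠ 0 := fun h => by
    have := congrArg Complex.re h; simp at this; linarith
  have n2 : 1 + (t:ℂ) ≠ 0 := fun h => by
    have := congrArg Complex.re h; simp at this; linarith
  have n3 : 1 + (t:ℂ) + s ≠ 0 := fun h => by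
    have := congrArg Complex.re h; simp at this; linarith
  have n4 : 1 + 2 * (t:ℂ) + s ≠ 0 := fun h => by
    have := congrArg Complex.re h; simp at this; linarith
  have n5 : 2 + 2 * (t:ℂ) + s ≠ 0 := fun h => by
    have := congrArg Complex.re h; simp at this; linarith
  have key := wz_rat t s n1 n2 n3 n4 n5
  rw [h4_eq, h4_eq, Gof, Gof, Aof_succ_s t s hs, Aof_succ_t t s hs, Kof_succ, Pof_quad, Pof_quad,
    Gamma_one_sub s h0, vof, vof, show 1 - (s + 1) = -s by ring]
  push_cast
  linear_combination (Kof t * Aof t s * Complex.Gamma (-s)) * key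

lemma wz_step (t : ℕ) (c : ℝ) (hc1 : -1/2 < c) (hc2 : c < 0) :
    ((1/2 + (t:ℂ)) ^ 4 / (1 + (t:ℂ)) ^ 4) *
      ∫ y : ℝ, h4 (t + 1) ((c : ℂ) + (y : ℂ) * Complex.I) =
      ∫ y : ℝ, h4 t ((c : ℂ) + (y : ℂ) * Complex.I) := by
  have ht : (0:ℝ) ≤ t := Nat.cast_nonneg t
  obtain ⟨C, hC⟩ := F_bound t c (c + 1) hc1 (by linarith)
    (fun s => -(Kof t * vof t s / (2 * (t:ℂ) + 1 + s)))
    (‖Kof t‖ * (4 * ‖(2:ℂ)‖ + 2 * ‖10 * (t:ℂ) + 4‖ + ‖8 * (t:ℂ) ^ 2 + 6 * (t:ℂ) + 1‖)) (by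
      intro s k1 k2 k3
      have hs := one_le_norm_of_im (2 * (t:ℂ) + 1 + s) (by simpa using k3)
      rw [norm_neg, norm_div, norm_mul]
      refine (div_le_self (by positivity) hs).trans ?_
      rw [mul_assoc]
      gcongr
      exact quad_bound _ _ _ s (by linarith) (by linarith) k3)
  have hd : DifferentiableOn ℂ (Gof t) {s | c ≤ s.re ∧ s.re ≤ c + 1} := by
    intro s hs
    have hs1 := hs.1
    have hs2 := hs.2
    have d1 := diff_Aof t s (by linarith)
    have d2 := diff_Gamma_one_sub s (by linarith)
    have d3 : DifferentiableAt ℂ (fun s => -(Kof t * vof t s / (2 * (t:ℂ) + 1 + s))) s := by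
      unfold vof
      refine DifferentiableAt.neg (DifferentiableAt.div (by fun_prop) (by fun_prop) ?_)
      intro h
      have := congrArg Complex.re h; simp at this; linarith
    exact (d3.mul (d1.mul d2)).differentiableWithinAt
  have sh := aux_shift (Gof t) c (c + 1) C (by linarith) hd hC
  have i1 := aux_line_int (Gof t) c (c + 1) c C le_rfl (by linarith) hd hC
  have i2 := aux_line_int (Gof t) c (c + 1) (c + 1) C (by linarith) le_rfl hd hC
  have j1 := h4_integrable t c hc1 (by linarith) hc2.ne
  have j2 := h4_integrable (t + 1) c hc1 (by linarith) hc2.ne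
  rw [← sub_eq_zero, ← integral_const_mul, ← integral_sub (j2.const_mul _) j1]
  rw [show (0:ℂ) = (∫ y : ℝ, Gof t (((c + 1 : ℝ) : ℂ) + (y : ℂ) * Complex.I)) -
    ∫ y : ℝ, Gof t ((c : ℂ) + (y : ℂ) * Complex.I) by rw [sh, sub_self], ← integral_sub i2 i1]
  refine integral_congr_ae (Filter.Eventually.of_forall fun y => ?_)
  simp only
  rw [wz_point t _ (by simpa using hc1) (line_ne_zero c y hc2.ne)]
  congr 2
  push_cast; ring

lemma h4_bound (t : ℕ) (a b : ℝ) (ha : -1/2 < a) (hb : b < 1) :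
    ∃ C : ℝ, ∀ s : ℂ, a ≤ s.re → s.re ≤ b → 1 ≤ |s.im| → ‖h4 t s‖ ≤ C / s.im ^ 2 := by
  obtain ⟨C, hC⟩ := F_bound t a b ha hb (fun s => Kof t * Pof t s / (-s))
    (‖Kof t‖ * (4 * ‖(10:ℂ)‖ + 2 * ‖14 * (t:ℂ) + 6‖ + ‖(2 * (t:ℂ) + 1) ^ 2‖)) (by
      intro s k1 k2 k3
      have hs := one_le_norm_of_im s k3
      rw [norm_div, norm_mul, norm_neg, Pof_quad]
      refine (div_le_self (by positivity) hs).trans ?_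
      rw [mul_assoc]
      gcongr
      exact quad_bound _ _ _ s (by linarith) (by linarith) k3)
  refine ⟨C, fun s k1 k2 k3 => ?_⟩
  have hs := one_le_norm_of_im s k3
  have h0 : s ≠ 0 := by rintro rfl; simp at hs; linarith
  rw [h4_eq' t s h0]
  exact hC s k1 k2 k3

lemma Gamma_neg_bound (a b : ℝ) (hb : b < 1) :
    ∃ C : ℝ, ∀ s : ℂ, a ≤ s.re → s.re ≤ b → 1 ≤ |s.im| →
      ‖Complex.Gamma (-s)‖ ≤ C / s.im ^ 2 := by
  have hc : ContinuousOn (fun x : ℝ => Real.Gamma (1 - x + 2)) (Set.Icc a b) := by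
    intro x hx
    have h2 : x < 1 := by linarith [hx.2]
    exact (contAt_Gamma (fun x => 1 - x + 2) x (by fun_prop) (by linarith)).continuousWithinAt
  obtain ⟨C, hC⟩ := isCompact_Icc.exists_bound_of_continuousOn hc
  refine ⟨C, fun s k1 k2 k3 => ?_⟩
  have hs := one_le_norm_of_im s k3
  have h0 : s ≠ 0 := by rintro rfl; simp at hs; linarith
  have b1 := norm_Gamma_decay 2 (1 - s) (by simp; linarith)
  have b2 := (le_abs_self _).trans (hC s.re ⟨k1, k2⟩)
  have hi : 0 < s.im ^ 2 := by rw [← sq_abs]; positivity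
  rw [le_div_iff₀ hi]
  refine le_trans ?_ b2
  simp only [Complex.sub_re, Complex.one_re, Complex.sub_im, Complex.one_im, zero_sub, abs_neg,
    sq_abs] at b1
  push_cast at b1
  refine le_trans ?_ b1
  rw [Gamma_one_sub s h0, norm_mul, norm_neg]
  gcongr
  exact le_mul_of_one_le_left (norm_nonneg _) hs

lemma Gamma_neg_diff (s : ℂ) (h0 : s ≠ 0) (h1 : s.re < 1) :
    DifferentiableAt ℂ (fun s => Complex.Gamma (-s)) s := by
  refine DifferentiableAt.comp (g := Complex.Gamma) s
    (Complex.differentiableAt_Gamma _ fun m hm => ?_) (by fun_prop)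
  have hm' : s = m := neg_injective hm
  rw [hm'] at h0 h1
  simp at h1 h0
  exact h0 h1

lemma Gamma_neg_integrable (x : ℝ) (h2 : x < 1) (h0 : x ≠ 0) :
    Integrable (fun y : ℝ => Complex.Gamma (-((x : ℂ) + (y : ℂ) * Complex.I))) := by
  obtain ⟨C, hC⟩ := Gamma_neg_bound x x h2
  refine aux_line_int (fun s => Complex.Gamma (-s)) x x x C le_rfl le_rfl ?_ hC
  intro s hs
  have hs0 : s ≠ 0 := by
    rintro rfl
    have := hs.1; have := hs.2
    simp at *
    exact h0 (by linarith)
  exact (Gamma_neg_diff s hs0 (by linarith [hs.2])).differentiableWithinAt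

lemma Gamma_neg_cpow_integrable (x r : ℝ) (h2 : x < 1) (h0 : x ≠ 0) :
    Integrable (fun y : ℝ => Complex.Gamma (-((x : ℂ) + (y : ℂ) * Complex.I)) *
      cpowR r ((x : ℂ) + (y : ℂ) * Complex.I)) := by
  refine (Gamma_neg_integrable x h2 h0).mul_bdd (c := Real.exp (x * Real.log r)) ?_ ?_
  · refine Continuous.aestronglyMeasurable ?_
    unfold cpowR; fun_prop
  · refine Filter.Eventually.of_forall fun y => ?_
    rw [norm_cpowR]; simp

lemma g_zero (t : ℕ) : Kof t * Aof t 0 * Pof t 0 = (2 * (t:ℂ) + 1) ^ 2 := by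
  have ht : (0:ℝ) ≤ t := Nat.cast_nonneg t
  have g1 : Complex.Gamma (1/2 + (t:ℂ)) ≠ 0 :=
    Complex.Gamma_ne_zero_of_re_pos (by simp; linarith)
  have g2 : Complex.Gamma (1/2) ≠ 0 :=
    Complex.Gamma_ne_zero_of_re_pos (by simp)
  have g3 : Complex.Gamma (1 + (t:ℂ)) ≠ 0 :=
    Complex.Gamma_ne_zero_of_re_pos (by simp; linarith)
  have g4 : Complex.Gamma (1 + 2 * (t:ℂ)) ≠ 0 :=
    Complex.Gamma_ne_zero_of_re_pos (by simp; linarith)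
  have e : Kof t * Aof t 0 = 1 := by
    rw [Kof, Aof, cpowR]
    simp only [add_zero, mul_zero, zero_mul, Complex.exp_zero, mul_one]
    generalize Complex.Gamma (1/2 + (t:ℂ)) = X1 at *
    generalize Complex.Gamma (1/2) = X2 at *
    generalize Complex.Gamma (1 + (t:ℂ)) = X3 at *
    generalize Complex.Gamma (1 + 2 * (t:ℂ)) = X4 at *
    field_simp
  rw [e, Pof_quad]; ring

lemma residue_x (t : ℕ) (c x : ℝ) (hc1 : -1/2 < c) (hc2 : c < 0) (hx : 0 < x) :
    (1 / (2*(π : ℂ))) * ∫ y : ℝ, h4 t ((c : ℂ) + (y : ℂ) * Complex.I) =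
    (2 * (t:ℂ) + 1) ^ 2 * (Real.exp (-x) : ℂ) - (2 * (t:ℂ) + 1) ^ 2 * ((1 / (2*(π : ℂ))) *
      ∫ y : ℝ, Complex.Gamma (-(((1/2 : ℝ) : ℂ) + (y : ℂ) * Complex.I)) *
        cpowR x (((1/2 : ℝ) : ℂ) + (y : ℂ) * Complex.I)) +
    (1 / (2*(π : ℂ))) * ∫ y : ℝ, h4 t (((1/2 : ℝ) : ℂ) + (y : ℂ) * Complex.I) := by
  set N : ℂ := (2 * (t:ℂ) + 1) ^ 2 with hN
  set g : ℂ → ℂ := fun s => Kof t * Aof t s * Pof t s - N * cpowR x s with hg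
  set F : ℂ → ℂ := fun s => Complex.Gamma (1 - s) * dslope g 0 s with hF
  have g0 : g 0 = 0 := by
    simp only [hg]
    rw [g_zero, cpowR]; simp [hN]
  have hFs : ∀ s : ℂ, s ≠ 0 → F s = N * (Complex.Gamma (-s) * cpowR x s) - h4 t s := by
    intro s hs
    simp only [hF]
    rw [dslope_of_ne _ hs, slope_def_field, g0, Gamma_one_sub s hs, h4_eq]
    simp only [hg]
    field_simp
    ring
  have hdg : DifferentiableOn ℂ g {s | -1/2 < s.re} := by
    intro s hs
    have d1 := diff_Aof t s hs
    have d2 : DifferentiableAt ℂ (fun s => Pof t s) s := by unfold Pof; fun_prop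
    have d3 : DifferentiableAt ℂ (fun s => N * cpowR x s) s := by unfold cpowR; fun_prop
    exact ((((differentiableAt_const _).mul d1).mul d2).sub d3).differentiableWithinAt
  have hopen : IsOpen {s : ℂ | -1/2 < s.re} := isOpen_lt continuous_const Complex.continuous_re
  have hds : DifferentiableOn ℂ (dslope g 0) {s | -1/2 < s.re} :=
    (Complex.differentiableOn_dslope (hopen.mem_nhds (by
      show (-1/2:ℝ) < (0:ℂ).re
      norm_num))).2 hdg
  have hdF : DifferentiableOn ℂ F {s | c ≤ s.re ∧ s.re ≤ 1/2} := by
    intro s hs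
    have hs1 := hs.1
    have hs2 := hs.2
    have hs' : s ∈ {s : ℂ | -1/2 < s.re} := by
      show -1/2 < s.re
      linarith
    exact ((diff_Gamma_one_sub s (by linarith)).mul
      (hds.differentiableAt (hopen.mem_nhds hs'))).differentiableWithinAt
  obtain ⟨C1, hC1⟩ := h4_bound t c (1/2) hc1 (by norm_num)
  obtain ⟨C2, hC2⟩ := Gamma_neg_bound c (1/2) (by norm_num)
  have hb : ∀ s : ℂ, c ≤ s.re → s.re ≤ 1/2 → 1 ≤ |s.im| →
      ‖F s‖ ≤ (‖N‖ * (C2 * Real.exp |Real.log x|) + C1) / s.im ^ 2 := by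
    intro s k1 k2 k3
    have hs := one_le_norm_of_im s k3
    have h0 : s ≠ 0 := by rintro rfl; simp at hs; linarith
    rw [hFs s h0]
    have q1 := hC1 s k1 k2 k3
    have q2 := hC2 s k1 k2 k3
    have q3 : ‖cpowR x s‖ ≤ Real.exp |Real.log x| := by
      rw [norm_cpowR]
      apply Real.exp_le_exp.2
      refine (le_abs_self _).trans ?_
      rw [abs_mul]
      exact mul_le_of_le_one_left (abs_nonneg _) (abs_le.2 ⟨by linarith, by linarith⟩)
    have q4 := (norm_nonneg _).trans q2
    calc _ ≤ ‖N * (Complex.Gamma (-s) * cpowR x s)‖ + ‖h4 t s‖ := norm_sub_le _ _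
      _ = ‖N‖ * (‖Complex.Gamma (-s)‖ * ‖cpowR x s‖) + ‖h4 t s‖ := by rw [norm_mul, norm_mul]
      _ ≤ ‖N‖ * ((C2 / s.im ^ 2) * Real.exp |Real.log x|) + C1 / s.im ^ 2 := by gcongr
      _ = _ := by ring
  have sh := aux_shift F c (1/2) _ (by linarith) hdF hb
  have split : ∀ u : ℝ, -1/2 < u → u < 1 → u ≠ 0 →
      ∫ y : ℝ, F ((u : ℂ) + (y : ℂ) * Complex.I) =
      N * (∫ y : ℝ, Complex.Gamma (-((u : ℂ) + (y : ℂ) * Complex.I)) *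
        cpowR x ((u : ℂ) + (y : ℂ) * Complex.I)) - ∫ y : ℝ, h4 t ((u : ℂ) + (y : ℂ) * Complex.I) := by
    intro u hu1 hu2 hu0
    rw [← integral_const_mul, ← integral_sub ((Gamma_neg_cpow_integrable u x hu2 hu0).const_mul N)
      (h4_integrable t u hu1 hu2 hu0)]
    refine integral_congr_ae (Filter.Eventually.of_forall fun y => ?_)
    simp only
    rw [hFs _ (line_ne_zero u y hu0)]
  rw [split c hc1 (by linarith) hc2.ne, split (1/2) (by norm_num) (by norm_num) (by norm_num)] at sh
  have me := mellin_exp c x hc2 hx (Gamma_neg_integrable c (by linarith) hc2.ne)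
  rw [← me]
  linear_combination (-(1 / (2*(π : ℂ)))) * sh

lemma residue_main (t : ℕ) (c : ℝ) (hc1 : -1/2 < c) (hc2 : c < 0) :
    (1 / (2*(π : ℂ))) * ∫ y : ℝ, h4 t ((c : ℂ) + (y : ℂ) * Complex.I) =
    (2 * (t:ℂ) + 1) ^ 2 +
    (1 / (2*(π : ℂ))) * ∫ y : ℝ, h4 t (((1/2 : ℝ) : ℂ) + (y : ℂ) * Complex.I) := by
  have l1 : Filter.Tendsto (fun x : ℝ => ((Real.exp (-x) : ℝ) : ℂ)) (nhdsWithin 0 (Set.Ioi 0)) (nhds 1) := by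
    have : Continuous (fun x : ℝ => ((Real.exp (-x) : ℝ) : ℂ)) := by fun_prop
    have := this.tendsto 0
    simp only [neg_zero, Real.exp_zero, Complex.ofReal_one] at this
    exact this.mono_left nhdsWithin_le_nhds
  have l2 : Filter.Tendsto (fun x : ℝ => ∫ y : ℝ, Complex.Gamma (-(((1/2 : ℝ) : ℂ) + (y : ℂ) * Complex.I)) *
        cpowR x (((1/2 : ℝ) : ℂ) + (y : ℂ) * Complex.I)) (nhdsWithin 0 (Set.Ioi 0)) (nhds 0) := by
    have e0 : Filter.Tendsto (fun x : ℝ => Real.exp (1/2 * Real.log x) *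
        ∫ y : ℝ, ‖Complex.Gamma (-(((1/2 : ℝ) : ℂ) + (y : ℂ) * Complex.I))‖)
        (nhdsWithin 0 (Set.Ioi 0)) (nhds 0) := by
      rw [show (0:ℝ) = 0 * ∫ y : ℝ, ‖Complex.Gamma (-(((1/2 : ℝ) : ℂ) + (y : ℂ) * Complex.I))‖ by simp]
      refine Filter.Tendsto.mul_const _ ?_
      rw [zero_mul]
      refine Real.tendsto_exp_atBot.comp ?_
      exact (Filter.tendsto_const_mul_atBot_of_pos (by norm_num)).2 Real.tendsto_log_nhdsGT_zero
    refine squeeze_zero_norm (fun x => ?_) e0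
    refine (norm_integral_le_integral_norm _).trans (le_of_eq ?_)
    rw [← integral_const_mul]
    refine integral_congr_ae (Filter.Eventually.of_forall fun y => ?_)
    simp only
    rw [norm_mul, norm_cpowR, mul_comm]
    simp
  have l3 := ((l1.const_mul ((2 * (t:ℂ) + 1) ^ 2)).sub
    ((l2.const_mul (1 / (2*(π : ℂ)))).const_mul ((2 * (t:ℂ) + 1) ^ 2))).add_const
    ((1 / (2*(π : ℂ))) * ∫ y : ℝ, h4 t (((1/2 : ℝ) : ℂ) + (y : ℂ) * Complex.I))
  have l4 := l3.congr' (f₂ := fun _ : ℝ => (1 / (2*(π : ℂ))) *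
      ∫ y : ℝ, h4 t ((c : ℂ) + (y : ℂ) * Complex.I)) (by
    filter_upwards [self_mem_nhdsWithin] with x hx
    exact (residue_x t c x hc1 hc2 hx).symm)
  have := tendsto_nhds_unique l4 tendsto_const_nhds
  rw [← this]
  ring

noncomputable def Krof (t : ℕ) : ℝ :=
  Real.Gamma (1 + (t:ℝ)) ^ 3 * Real.Gamma (1 + 2 * (t:ℝ)) /
    (Real.Gamma (1/2 + (t:ℝ)) ^ 3 * Real.Gamma (1/2) ^ 2)

lemma Kof_real (t : ℕ) : Kof t = (Krof t : ℂ) := by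
  rw [Kof, Krof]
  push_cast [← Complex.Gamma_ofReal]
  rfl

lemma Krof_nonneg (t : ℕ) : 0 ≤ Krof t := by
  have ht : (0:ℝ) ≤ t := Nat.cast_nonneg t
  have g1 := Real.Gamma_pos_of_pos (show 0 < 1/2 + (t:ℝ) by linarith)
  have g2 := Real.Gamma_pos_of_pos (show 0 < 1 + (t:ℝ) by linarith)
  have g4 := Real.Gamma_pos_of_pos (show 0 < 1 + 2 * (t:ℝ) by linarith)
  rw [Krof]; positivity

lemma KD_le (t : ℕ) : Krof t * Dof t (1/2) ≤ (2 / π) / √(2 * t + 1/2) := by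
  have ht : (0:ℝ) ≤ t := Nat.cast_nonneg t
  have g1 := Real.Gamma_pos_of_pos (show 0 < 1/2 + (t:ℝ) by linarith)
  have g2 := Real.Gamma_pos_of_pos (show 0 < 1 + (t:ℝ) by linarith)
  have g3 := Real.Gamma_pos_of_pos (show 0 < 1 + (t:ℝ) + 1/2 by linarith)
  have g4 := Real.Gamma_pos_of_pos (show 0 < 1 + 2 * (t:ℝ) by linarith)
  have g5 := Real.Gamma_pos_of_pos (show 0 < 1 + 2 * (t:ℝ) + 1/2 by linarith)
  have m1 := Gamma_mid (1/2 + t) (by linarith)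
  have m2 := Gamma_mid (1/2 + 2 * t) (by linarith)
  have r2 := Real.Gamma_add_one (s := 1/2 + 2 * (t:ℝ)) (by linarith)
  rw [show 1/2 + (t:ℝ) + 1/2 = 1 + t by ring, show 1/2 + (t:ℝ) + 1 = 1 + t + 1/2 by ring] at m1
  rw [show 1/2 + 2 * (t:ℝ) + 1/2 = 1 + 2 * t by ring, show 1/2 + 2 * (t:ℝ) + 1 = 1 + 2 * t + 1/2 by ring] at m2
  rw [show 1/2 + 2 * (t:ℝ) + 1 = 1 + 2 * t + 1/2 by ring] at r2
  have e : Real.exp (2 * (1/2) * Real.log 2) = 2 := by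
    rw [show 2 * (1/2 : ℝ) * Real.log 2 = Real.log 2 by ring, Real.exp_log (by norm_num)]
  have e1 : (1/2 + (t:ℝ) + 1/2) = 1 + t := by ring
  have e2 : Real.Gamma (1/2 + 1/2) = 1 := by norm_num
  have e3 : Real.Gamma (1/2) ^ 2 = π := by
    rw [Real.Gamma_one_half_eq, Real.sq_sqrt Real.pi_pos.le]
  rw [Krof, Dof, e, e1, e2, e3]
  set X1 := Real.Gamma (1/2 + (t:ℝ))
  set X2 := Real.Gamma (1 + (t:ℝ))
  set X3 := Real.Gamma (1 + (t:ℝ) + 1/2)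
  set X4 := Real.Gamma (1 + 2 * (t:ℝ))
  set X5 := Real.Gamma (1 + 2 * (t:ℝ) + 1/2)
  have hp := Real.pi_pos
  have hq : 0 < 2 * (t:ℝ) + 1/2 := by linarith
  have a1 : X2 ^ 2 / (X1 * X3) ≤ 1 := (div_le_one (by positivity)).2 m1
  have a2 : X4 / X5 ≤ 1 / √(2 * t + 1/2) := by
    rw [div_le_div_iff₀ g5 (by positivity), one_mul]
    refine le_of_sq_le_sq ?_ g5.le
    rw [mul_pow, Real.sq_sqrt hq.le]
    calc X4 ^ 2 * (2 * t + 1/2) ≤ Real.Gamma (1/2 + 2 * t) * X5 * (2 * t + 1/2) := by gcongr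
      _ = X5 ^ 2 := by rw [sq]; nth_rewrite 2 [r2]; ring
  calc _ = (X2 ^ 2 / (X1 * X3)) ^ 3 * (X4 / X5) * (2 / π) := by field_simp
    _ ≤ 1 ^ 3 * (1 / √(2 * t + 1/2)) * (2 / π) := by gcongr
    _ = _ := by ring

noncomputable def Phi (y : ℝ) : ℝ :=
  ‖Complex.Gamma (1/2 + (((1/2 : ℝ) : ℂ) + (y : ℂ) * Complex.I))‖ *
    ‖Complex.Gamma (-(((1/2 : ℝ) : ℂ) + (y : ℂ) * Complex.I))‖ *
    (10 * ‖((1/2 : ℝ) : ℂ) + (y : ℂ) * Complex.I‖ ^ 2 +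
      7 * ‖((1/2 : ℝ) : ℂ) + (y : ℂ) * Complex.I‖ + 1)

lemma Phi_integrable : Integrable Phi := by
  obtain ⟨C, hC⟩ := Gamma_neg_bound (1/2) (1/2) (by norm_num)
  have c1 : Continuous (fun y : ℝ => Complex.Gamma (1/2 + (((1/2 : ℝ) : ℂ) + (y : ℂ) * Complex.I))) :=
    aux_line_cont (fun s => Complex.Gamma (1/2 + s)) (1/2) (1/2) (1/2) le_rfl le_rfl (by
      intro s hs
      exact (diff_Gamma (fun s => 1/2 + s) s (by fun_prop)
        (by have := hs.1; simp; linarith)).differentiableWithinAt)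
  have c2 : Continuous (fun y : ℝ => Complex.Gamma (-(((1/2 : ℝ) : ℂ) + (y : ℂ) * Complex.I))) :=
    aux_line_cont (fun s => Complex.Gamma (-s)) (1/2) (1/2) (1/2) le_rfl le_rfl (by
      intro s hs
      refine (Gamma_neg_diff s ?_ (by linarith [hs.2])).differentiableWithinAt
      rintro rfl
      have := hs.1
      norm_num at this)
  refine aux_integrable Phi ?_ (Real.Gamma 3 * C * 55) ?_
  · unfold Phi
    exact (c1.norm.mul c2.norm).mul (by fun_prop)
  · intro y hy
    set s : ℂ := ((1/2 : ℝ) : ℂ) + (y : ℂ) * Complex.I with hs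
    have hre : s.re = 1/2 := by simp [hs]
    have him : s.im = y := by simp [hs]
    have b1 := norm_Gamma_decay 2 (1/2 + s) (by simp [hre])
    have b2 := hC s hre.ge hre.le (by rwa [him])
    have b3 : 10 * ‖s‖ ^ 2 + 7 * ‖s‖ + 1 ≤ 55 * y ^ 2 := by
      have h1 : ‖s‖ ≤ 2 * |y| := by
        have := Complex.norm_le_abs_re_add_abs_im s
        rw [hre, him] at this
        have h2 : |(1/2 : ℝ)| ≤ 1 := by rw [abs_of_pos] <;> norm_num
        linarith
      rw [← sq_abs y]
      nlinarith [norm_nonneg s]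
    have e1 : (1/2 + s).im = y := by simp [him]
    have e2 : (1/2 + s).re + ((2:ℕ):ℝ) = 3 := by simp [hre]; norm_num
    rw [e1, e2, sq_abs] at b1
    rw [him] at b2
    have hy2 : 0 < y ^ 2 := by rw [← sq_abs]; positivity
    have hP : ‖Phi y‖ = ‖Complex.Gamma (1/2 + s)‖ * ‖Complex.Gamma (-s)‖ * (10 * ‖s‖ ^ 2 + 7 * ‖s‖ + 1) := by
      rw [Real.norm_of_nonneg (by unfold Phi; positivity), Phi]
    have b1' : ‖Complex.Gamma (1/2 + s)‖ ≤ Real.Gamma 3 / y ^ 2 := by rwa [le_div_iff₀ hy2]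
    have g3 := Real.Gamma_pos_of_pos (show (0:ℝ) < 3 by norm_num)
    have b2' := (norm_nonneg _).trans b2
    rw [hP]
    calc _ ≤ (Real.Gamma 3 / y ^ 2) * (C / y ^ 2) * (55 * y ^ 2) := by gcongr
      _ = _ := by field_simp

lemma err_bound (t : ℕ) : ‖∫ y : ℝ, h4 t (((1/2 : ℝ) : ℂ) + (y : ℂ) * Complex.I)‖ ≤
    (2 * (t:ℝ) + 1) ^ 2 * ((2 / π) / √(2 * t + 1/2)) * ∫ y, Phi y := by
  rw [← integral_const_mul]
  refine norm_integral_le_of_norm_le (Phi_integrable.const_mul _)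
    (Filter.Eventually.of_forall fun y => ?_)
  have ht : (0:ℝ) ≤ t := Nat.cast_nonneg t
  rw [Phi]
  set s : ℂ := ((1/2 : ℝ) : ℂ) + (y : ℂ) * Complex.I with hs
  have hre : s.re = 1/2 := by simp [hs]
  have a1 := norm_Aof_le t s (by rw [hre]; norm_num)
  rw [hre] at a1
  have kd := KD_le t
  have k0 := Krof_nonneg t
  have d0 := Dof_nonneg t (1/2) (by norm_num)
  have p1 : ‖Pof t s‖ ≤ (2 * (t:ℝ) + 1) ^ 2 * (10 * ‖s‖ ^ 2 + 7 * ‖s‖ + 1) := by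
    have n1 : ‖14 * (t:ℂ) + 6‖ = 14 * t + 6 := by
      rw [show 14 * (t:ℂ) + 6 = ((14 * t + 6 : ℝ) : ℂ) by push_cast; ring, Complex.norm_real,
        Real.norm_of_nonneg (by positivity)]
    have n2 : ‖2 * (t:ℂ) + 1‖ = 2 * t + 1 := by
      rw [show 2 * (t:ℂ) + 1 = ((2 * t + 1 : ℝ) : ℂ) by push_cast; ring, Complex.norm_real,
        Real.norm_of_nonneg (by positivity)]
    rw [Pof_quad]
    calc _ ≤ ‖10 * s ^ 2‖ + ‖(14 * (t:ℂ) + 6) * s‖ + ‖(2 * (t:ℂ) + 1) ^ 2‖ :=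
          (norm_add_le _ _).trans (by gcongr; exact norm_add_le _ _)
      _ = 10 * ‖s‖ ^ 2 + (14 * t + 6) * ‖s‖ + (2 * t + 1) ^ 2 := by
          rw [norm_mul, norm_mul, norm_pow, norm_pow, n1, n2]; simp
      _ ≤ _ := by
          have q1 : (1:ℝ) ≤ (2 * t + 1) ^ 2 := by nlinarith
          have q2 : 14 * (t:ℝ) + 6 ≤ 7 * (2 * t + 1) ^ 2 := by nlinarith
          nlinarith [mul_nonneg (sub_nonneg.2 q1) (sq_nonneg ‖s‖),
            mul_nonneg (sub_nonneg.2 q2) (norm_nonneg s)]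
  rw [h4_eq, norm_mul, norm_mul, norm_mul, Kof_real, Complex.norm_real, Real.norm_of_nonneg k0]
  calc _ ≤ Krof t * (Dof t (1/2) * ‖Complex.Gamma (1/2 + s)‖) *
        ((2 * (t:ℝ) + 1) ^ 2 * (10 * ‖s‖ ^ 2 + 7 * ‖s‖ + 1)) * ‖Complex.Gamma (-s)‖ := by gcongr
    _ = (2 * (t:ℝ) + 1) ^ 2 * (Krof t * Dof t (1/2)) * (‖Complex.Gamma (1/2 + s)‖ *
        ‖Complex.Gamma (-s)‖ * (10 * ‖s‖ ^ 2 + 7 * ‖s‖ + 1)) := by ring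
    _ ≤ _ := by gcongr

noncomputable def Jof (c : ℝ) (t : ℕ) : ℂ :=
  (1 / (2*(π : ℂ))) * ∫ y : ℝ, h4 t ((c : ℂ) + (y : ℂ) * Complex.I)

lemma Jof_tendsto (c : ℝ) (hc1 : -1/2 < c) (hc2 : c < 0) :
    Filter.Tendsto (fun t : ℕ => Jof c t / (2 * (t:ℂ) + 1) ^ 2) Filter.atTop (nhds 1) := by
  rw [tendsto_iff_norm_sub_tendsto_zero]
  have hlim : Filter.Tendsto (fun t : ℕ => (‖(1 / (2*(π : ℂ)))‖ * (2 / π) * ∫ y, Phi y) /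
      √(2 * t + 1/2)) Filter.atTop (nhds 0) := by
    refine tendsto_const_nhds.div_atTop ?_
    refine Real.tendsto_sqrt_atTop.comp ?_
    refine Filter.tendsto_atTop_add_const_right _ _ ?_
    exact Filter.Tendsto.const_mul_atTop (by norm_num) tendsto_natCast_atTop_atTop
  refine squeeze_zero (fun _ => norm_nonneg _) (fun t => ?_) hlim
  have ht : (0:ℝ) ≤ t := Nat.cast_nonneg t
  have n2 : ‖2 * (t:ℂ) + 1‖ = 2 * t + 1 := by
    rw [show 2 * (t:ℂ) + 1 = ((2 * t + 1 : ℝ) : ℂ) by push_cast; ring, Complex.norm_real,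
      Real.norm_of_nonneg (by positivity)]
  have n3 : 2 * (t:ℂ) + 1 ≠ 0 := by
    rw [← norm_ne_zero_iff, n2]; positivity
  rw [Jof, residue_main t c hc1 hc2, add_div, div_self (pow_ne_zero 2 n3), add_sub_cancel_left,
    norm_div, norm_mul, norm_pow, n2, div_le_iff₀ (by positivity)]
  have := err_bound t
  calc _ ≤ ‖(1 / (2*(π : ℂ)))‖ * ((2 * (t:ℝ) + 1) ^ 2 * ((2 / π) / √(2 * t + 1/2)) * ∫ y, Phi y) := by
        gcongr
    _ = _ := by ring

lemma pochR_pos (a : ℝ) (ha : 0 < a) (n : ℕ) : 0 < pochR a n :=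
  Finset.prod_pos fun i _ => by positivity

lemma Jof_rec (c : ℝ) (hc1 : -1/2 < c) (hc2 : c < 0) (t : ℕ) :
    Jof c t = Jof c 0 * (((pochR 1 t / pochR (1/2) t) ^ 4 : ℝ) : ℂ) := by
  induction t with
  | zero => simp [pochR]
  | succ t ih =>
    have h := wz_step t c hc1 hc2
    have ht : (0:ℝ) ≤ t := Nat.cast_nonneg t
    have n1 : 1/2 + (t:ℂ) ≠ 0 := fun h => by
      have := congrArg Complex.re h; simp at this; linarith
    have n2 : 1 + (t:ℂ) ≠ 0 := fun h => by
      have := congrArg Complex.re h; simp at this; linarith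
    have h' : Jof c (t + 1) = (1 + (t:ℂ)) ^ 4 / (1/2 + (t:ℂ)) ^ 4 * Jof c t := by
      rw [Jof, Jof, ← h]
      generalize (1/2 + (t:ℂ)) = b at *
      generalize (∫ y : ℝ, h4 (t+1) ((c:ℂ) + (y:ℂ) * Complex.I)) = Z
      field_simp
    have e : ∀ a : ℝ, pochR a (t+1) = pochR a t * (a + t) := fun a => by
      rw [pochR, Finset.prod_range_succ, ← pochR]
    rw [h', ih, e, e, mul_div_mul_comm]
    push_cast
    rw [mul_pow, div_pow (1 + (t:ℂ))]
    ring

lemma W_eq (t : ℕ) : Real.Wallis.W t = (pochR 1 t / pochR (1/2) t) ^ 2 / (2 * t + 1) := by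
  induction t with
  | zero => simp [pochR, Real.Wallis.W]
  | succ t ih =>
    have p1 := (pochR_pos (1/2) (by norm_num) t).ne'
    rw [Real.Wallis.W_succ, ih]
    have e : ∀ a : ℝ, pochR a (t + 1) = pochR a t * (a + t) := fun a => by
      rw [pochR, Finset.prod_range_succ, ← pochR]
    rw [e, e]
    push_cast
    have h1 : (1/2 + (t:ℝ)) = (2 * t + 1) / 2 := by ring
    have h2 : (2 * ((t:ℝ) + 1) + 1) = 2 * t + 3 := by ring
    rw [h1, h2]
    have q1 : 2 * (t:ℝ) + 1 ≠ 0 := by positivity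
    have q2 : 2 * (t:ℝ) + 3 ≠ 0 := by positivity
    generalize pochR (1/2) t = Y at *
    field_simp
    ring

lemma Jof_zero (c : ℝ) (hc1 : -1/2 < c) (hc2 : c < 0) : Jof c 0 = ((4 / π ^ 2 : ℝ) : ℂ) := by
  have l1 := Jof_tendsto c hc1 hc2
  have l2 : Filter.Tendsto (fun t : ℕ => Jof c 0 * ((Real.Wallis.W t ^ 2 : ℝ) : ℂ)) Filter.atTop
      (nhds (Jof c 0 * (((π / 2) ^ 2 : ℝ) : ℂ))) := by
    refine Filter.Tendsto.const_mul _ ?_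
    exact (Complex.continuous_ofReal.tendsto _).comp (Real.Wallis.tendsto_W_nhds_pi_div_two.pow 2)
  have l3 := l2.congr (f₂ := fun t : ℕ => Jof c t / (2 * (t:ℂ) + 1) ^ 2) (fun t => by
    rw [Jof_rec c hc1 hc2 t, W_eq]
    push_cast
    generalize 2 * (t:ℂ) + 1 = D
    ring)
  have h := tendsto_nhds_unique l3 l1
  have hp : (π : ℂ) ≠ 0 := by exact_mod_cast Real.pi_ne_zero
  push_cast at h ⊢
  field_simp at h ⊢
  linear_combination h

theorem barnes_integral_4_over_pi_sq_param (t : ℕ) (c : ℝ) (hc1 : -1/2 < c) (hc2 : c < 0) :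
    Integrable (fun y : ℝ => h4 t ((c : ℂ) + (y : ℂ) * Complex.I)) ∧
    (1 / (2*(π : ℂ))) * ∫ y : ℝ, h4 t ((c : ℂ) + (y : ℂ) * Complex.I) =
      ((4 / π^2) * (pochR 1 t)^4 / (pochR (1/2) t)^4 : ℝ) := by
  refine ⟨h4_integrable t c hc1 (by linarith) hc2.ne, ?_⟩
  have h := Jof_rec c hc1 hc2 t
  rw [Jof_zero c hc1 hc2, Jof] at h
  rw [h, ← Complex.ofReal_mul, div_pow, mul_div_assoc]
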